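/- (Lossless time discretization.) Let T > 0, Δt > 0 with K = T/Δt a positive integer, and let 0 < γ ≤ Γ ≤ T and 0 < γ̂ ≤ Γ̂ ≤ T with γ/Δt, Γ/Δt, γ̂/Δt, Γ̂/Δt positive integers. Fix η⁺, η⁻ ∈ (0,1], vectors 𝐝, ȳ⁺, ȳ⁻ ∈ ℝ^K with nonnegative components such that x^b_·, x^r_· constraints apply, and assume that for every k, d_k > 0 implies ȳ⁺_k = ȳ⁻_k = 0 (the vehicle is disconnected while driving). Fix bounds y̲ ≤ ȳ, a target y* ∈ ℝ, a penalty p* ≥ 0, intervals Y₀ = [y̲₀, ȳ₀] and Ŷ₀ = [ŷ̲₀, ŷ̄₀], cost coefficients 𝐩^b, 𝐩^r ∈ ℝ^K, a feasible set X_K ⊆ ℝ₊^K, and let c_K(𝐱^b,𝐱^r) = Δt Σ_{k=1}^{K}(p^b_k x^b_k − p^r_k x^r_k). Then the optimal value of the continuous-time robust problem (R) — minimize over 𝐱^b, 𝐱^r ∈ X_K (with continuous decisions x^b = L𝐱^b, x^r = L𝐱^r) the quantity c_K(𝐱^b,𝐱^r) + sup_{δ ∈ D̂, y₀ ∈ Ŷ₀}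 p*·|y(x^b,x^r,δ,y₀,T) − y*| subject to [x^b(t)+δ(t)x^r(t)]⁺ ≤ (Lȳ⁺)(t), [x^b(t)+δ(t)x^r(t)]⁻ ≤ (Lȳ⁻)(t), and y̲ ≤ y(x^b,x^r,δ,y₀,t) ≤ ȳ for all δ ∈ D, t ∈ [0,T], y₀ ∈ Y₀ — equals the optimal value of the discrete-time robust problem (R_K): minimize over 𝐱^b, 𝐱^r ∈ X_K the quantity c_K(𝐱^b,𝐱^r) + max_{𝛅 ∈ D̂_K, y₀ ∈ Ŷ₀} p*·|y_K(𝐱^b,𝐱^r,𝛅,y₀) − y*| subject to [x^b_k+δ_k x^r_k]⁺ ≤ ȳ⁺_k, [x^b_k+δ_k x^r_k]⁻ ≤ ȳ⁻_k for all 𝛅 ∈ D_K and k ∈ {1,…,K}, and y̲ ≤ y_k(𝐱^b,𝐱^r,𝛅,y₀) ≤ ȳ for all 𝛅 ∈ D_K, k ∈ {0,…,K}, y₀ ∈ Y₀. In fact the two problems have identical feasible sets of vectors (𝐱^b, 𝐱^r) and identical objective values for each feasible point. -/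

import Mathlib

open MeasureTheory Set

noncomputable section

/-- The continuous-time uncertainty set `D` of measurable frequency-deviation
scenarios `δ : [0,T] → [-1,1]` whose total absolute deviation over every
backward window of length `Γ` is at most `γ`. -/
def Dset (T Γ γ : ℝ) : Set (ℝ → ℝ) :=
  {δ | Measurable δ ∧ (∀ t ∈ Icc (0:ℝ) T, δ t ∈ Icc (-1:ℝ) 1) ∧
    ∀ t ∈ Icc (0:ℝ) T, (∫ s in (max (t - Γ) 0)..t, |δ s|) ≤ γ}

/-- The nonnegative part `D⁺` of the continuous uncertainty set. -/
def DsetPlus (T Γ γ : ℝ) : Set (ℝ → ℝ) :=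
  Dset T Γ γ ∩ {δ | ∀ t ∈ Icc (0:ℝ) T, δ t ∈ Icc (0:ℝ) 1}

/-- The discrete uncertainty set `D_K` (with `0`-based indexing): vectors in
`[-1,1]^K` whose sum of absolute values over each backward window of `W = Γ/Δt`
periods is at most `g = γ/Δt`. -/
def DK (K W g : ℕ) : Set (Fin K → ℝ) :=
  {δ | (∀ l, |δ l| ≤ 1) ∧ ∀ k : Fin K,
    (∑ l ∈ Finset.univ.filter
      (fun l : Fin K => (k : ℕ) + 1 - W ≤ (l : ℕ) ∧ (l : ℕ) ≤ (k : ℕ)), |δ l|) ≤ (g : ℝ)}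

/-- The nonnegative part `D_K⁺` of the discrete uncertainty set. -/
def DKplus (K W g : ℕ) : Set (Fin K → ℝ) :=
  DK K W g ∩ {δ | ∀ l, 0 ≤ δ l}

/-- The lifting operator `L` mapping a vector to the piecewise constant function
with value `v k` on `[kΔt, (k+1)Δt)` (0-based), and `v (K-1)` at `t = KΔt`. -/
def lift (Δt : ℝ) {K : ℕ} (v : Fin K → ℝ) : ℝ → ℝ := fun t =>
  if h : min (⌊t / Δt⌋.toNat) (K - 1) < K then v ⟨min (⌊t / Δt⌋.toNat) (K - 1), h⟩ else 0

/-- The averaging operator `L†` mapping a function to its vector of averages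
over the trading intervals. -/
def avg (Δt : ℝ) (K : ℕ) (w : ℝ → ℝ) : Fin K → ℝ := fun k =>
  (1 / Δt) * ∫ s in (((k : ℕ) : ℝ) * Δt)..((((k : ℕ) : ℝ) + 1) * Δt), w s

/-- The integrand of the continuous-time state-of-charge. -/
def socIntegrand (ηp ηm : ℝ) (xb xr δ d : ℝ → ℝ) (s : ℝ) : ℝ :=
  ηp * max (xb s + δ s * xr s) 0 - (1 / ηm) * max (-(xb s + δ s * xr s)) 0 - d s

/-- The continuous-time state-of-charge `y(x^b, x^r, δ, y₀, t)`. -/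
def soc (ηp ηm : ℝ) (xb xr δ d : ℝ → ℝ) (y0 t : ℝ) : ℝ :=
  y0 + ∫ s in (0:ℝ)..t, socIntegrand ηp ηm xb xr δ d s

/-- The discrete-time state-of-charge `y_k(𝐱^b, 𝐱^r, 𝛅, y₀)` (0-based indexing:
the sum extends over the first `k` components). -/
def ysoc (Δt ηp ηm : ℝ) {K : ℕ} (xb xr δ d : Fin K → ℝ) (y0 : ℝ) (k : ℕ) : ℝ :=
  y0 + Δt * ∑ l ∈ Finset.univ.filter (fun l : Fin K => (l : ℕ) < k),
    (ηp * max (xb l + δ l * xr l) 0 - (1 / ηm) * max (-(xb l + δ l * xr l)) 0 - d l)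

/-- Feasibility of the market decisions in the continuous-time robust problem (R). -/
def contFeasible (T Γ γ Δt ηp ηm : ℝ) {K : ℕ} (d ybarp ybarm : Fin K → ℝ)
    (ylo yhi yl0 yu0 : ℝ) (xb xr : Fin K → ℝ) : Prop :=
  ∀ δ ∈ Dset T Γ γ, ∀ t ∈ Icc (0:ℝ) T,
    max (lift Δt xb t + δ t * lift Δt xr t) 0 ≤ lift Δt ybarp t ∧
    max (-(lift Δt xb t + δ t * lift Δt xr t)) 0 ≤ lift Δt ybarm t ∧
    ∀ y0 ∈ Icc yl0 yu0,
      ylo ≤ soc ηp ηm (lift Δt xb) (lift Δt xr) δ (lift Δt d) y0 t ∧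
      soc ηp ηm (lift Δt xb) (lift Δt xr) δ (lift Δt d) y0 t ≤ yhi

/-- Feasibility of the market decisions in the discrete-time robust problem (R_K). -/
def discFeasible (Δt ηp ηm : ℝ) (W g : ℕ) {K : ℕ} (d ybarp ybarm : Fin K → ℝ)
    (ylo yhi yl0 yu0 : ℝ) (xb xr : Fin K → ℝ) : Prop :=
  ∀ δ ∈ DK K W g,
    (∀ k : Fin K, max (xb k + δ k * xr k) 0 ≤ ybarp k ∧
      max (-(xb k + δ k * xr k)) 0 ≤ ybarm k) ∧
    ∀ k ≤ K, ∀ y0 ∈ Icc yl0 yu0,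
      ylo ≤ ysoc Δt ηp ηm xb xr δ d y0 k ∧ ysoc Δt ηp ηm xb xr δ d y0 k ≤ yhi

/-- Worst-case terminal deviation penalty of the continuous-time problem (R). -/
def contPenalty (T Γh γh Δt ηp ηm : ℝ) {K : ℕ} (d : Fin K → ℝ)
    (ylh yuh pstar ystar : ℝ) (xb xr : Fin K → ℝ) : ℝ :=
  sSup {v : ℝ | ∃ δ ∈ Dset T Γh γh, ∃ y0 ∈ Icc ylh yuh,
    v = pstar * |soc ηp ηm (lift Δt xb) (lift Δt xr) δ (lift Δt d) y0 T - ystar|}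

/-- Worst-case terminal deviation penalty of the discrete-time problem (R_K). -/
def discPenalty (Δt ηp ηm : ℝ) (Wh gh : ℕ) {K : ℕ} (d : Fin K → ℝ)
    (ylh yuh pstar ystar : ℝ) (xb xr : Fin K → ℝ) : ℝ :=
  sSup {v : ℝ | ∃ δ ∈ DK K Wh gh, ∃ y0 ∈ Icc ylh yuh,
    v = pstar * |ysoc Δt ηp ηm xb xr δ d y0 K - ystar|}


/-! ### Randomized rounding of fractional scenarios -/

theorem sum_filter_fin_eq_sum_Ico {K m : ℕ} (k : Fin K) (F : Fin K → ℝ) (G : ℕ → ℝ)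
    (hFG : ∀ l : Fin K, F l = G l) :
    ∑ l ∈ Finset.univ.filter (fun l : Fin K => m ≤ (l : ℕ) ∧ (l : ℕ) ≤ (k : ℕ)), F l =
      ∑ j ∈ Finset.Ico m ((k : ℕ) + 1), G j := by
  refine Finset.sum_bij (fun l _ => (l : ℕ)) ?_ ?_ ?_ ?_
  · intro l hl
    simpa [Nat.lt_succ_iff] using hl
  · intro l _ l' _ h
    exact Fin.ext h
  · intro j hj
    rw [Finset.mem_Ico] at hj
    exact ⟨⟨j, by omega⟩, by simp only [Finset.mem_filter, Finset.mem_univ, true_and]; omega, rfl⟩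
  · intro l _
    exact hFG l

theorem sum_filter_lt_succ {K k : ℕ} (hk : k < K) (F : Fin K → ℝ) :
    ∑ l ∈ Finset.univ.filter (fun l : Fin K => (l : ℕ) < k + 1), F l =
      ∑ l ∈ Finset.univ.filter (fun l : Fin K => (l : ℕ) < k), F l + F ⟨k, hk⟩ := by
  have h : Finset.univ.filter (fun l : Fin K => (l : ℕ) < k + 1) =
      insert ⟨k, hk⟩ (Finset.univ.filter (fun l : Fin K => (l : ℕ) < k)) := by
    ext l
    simp [Fin.ext_iff]
    omega
  rw [h, Finset.sum_insert (by simp), add_comm]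

theorem intervalIntegrable_fract (a b : ℝ) : IntervalIntegrable Int.fract volume a b := by
  rw [intervalIntegrable_iff]
  refine MeasureTheory.Measure.integrableOn_of_bounded (M := 1) (by simp)
    measurable_fract.aestronglyMeasurable ?_
  refine ae_of_all _ fun x => ?_
  rw [Real.norm_eq_abs, abs_of_nonneg (Int.fract_nonneg x)]
  exact (Int.fract_lt_one x).le

theorem integral_fract_add (s : ℝ) : ∫ u in (0:ℝ)..1, Int.fract (s + u) = 1 / 2 := by
  have hper : Function.Periodic (Int.fract : ℝ → ℝ) 1 := fun x => Int.fract_add_one x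
  rw [intervalIntegral.integral_comp_add_left (fun u => Int.fract u), add_zero,
    hper.intervalIntegral_add_eq s 0, zero_add,
    intervalIntegral.integral_congr_Ioo_of_le (g := fun x => x) zero_le_one
      (fun x hx => Int.fract_eq_self.2 ⟨hx.1.le, hx.2⟩)]
  simp

theorem intervalIntegrable_floor_add (s : ℝ) :
    IntervalIntegrable (fun u => ((⌊s + u⌋ : ℤ) : ℝ)) volume 0 1 := by
  have h1 : (fun u => ((⌊s + u⌋ : ℤ) : ℝ)) = fun u => (s + u) - Int.fract (s + u) := by
    funext u
    rw [Int.self_sub_fract]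
  rw [h1]
  refine IntervalIntegrable.sub
    ((by fun_prop : Continuous fun u : ℝ => s + u).intervalIntegrable _ _) ?_
  simpa using (intervalIntegrable_fract s (s + 1)).comp_add_left s

theorem integral_floor_add (s : ℝ) : ∫ u in (0:ℝ)..1, ((⌊s + u⌋ : ℤ) : ℝ) = s := by
  have h := intervalIntegral.integral_add (intervalIntegrable_floor_add s)
    (show IntervalIntegrable (fun u => Int.fract (s + u)) volume 0 1 by
      simpa using (intervalIntegrable_fract s (s + 1)).comp_add_left s)
  simp only [Int.floor_add_fract] at h
  rw [integral_fract_add, intervalIntegral.integral_add (by simp) (by simp)] at h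
  simp at h
  linarith

/-- A linear functional on the nonnegative part of the discrete uncertainty set is dominated
by its value at some zero-one scenario. -/
theorem exists_zero_one_mem_DK {K W g : ℕ} {w : Fin K → ℝ} (hw : w ∈ DKplus K W g)
    (c : Fin K → ℝ) :
    ∃ b ∈ DK K W g, (∀ l, b l = 0 ∨ b l = 1) ∧ ∑ l, c l * w l ≤ ∑ l, c l * b l := by
  obtain ⟨⟨hw1, hwin⟩, hw0⟩ := hw
  set S : ℕ → ℝ := fun n => ∑ l ∈ Finset.univ.filter (fun l : Fin K => (l : ℕ) < n), w l with hS
  have hSsucc : ∀ l : Fin K, S (l + 1) = S l + w l := fun l => sum_filter_lt_succ l.2 w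
  set B : ℝ → Fin K → ℝ := fun u l => ((⌊S (l + 1) + u⌋ : ℤ) : ℝ) - ((⌊S l + u⌋ : ℤ) : ℝ) with hB
  have hB01 : ∀ u l, B u l = 0 ∨ B u l = 1 := by
    intro u l
    have h0 : ⌊S l + u⌋ ≤ ⌊S (l + 1) + u⌋ := Int.floor_mono (by rw [hSsucc]; linarith [hw0 l])
    have h1 : ⌊S (l + 1) + u⌋ ≤ ⌊S l + u⌋ + 1 := by
      rw [← Int.floor_add_one]
      exact Int.floor_mono (by rw [hSsucc]; linarith [le_abs_self (w l), hw1 l])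
    rcases (by omega : ⌊S (l + 1) + u⌋ = ⌊S l + u⌋ ∨ ⌊S (l + 1) + u⌋ = ⌊S l + u⌋ + 1) with h | h
    · left; simp [hB, h]
    · right; simp [hB, h]
  have hBDK : ∀ u, B u ∈ DK K W g := by
    intro u
    refine ⟨fun l => by rcases hB01 u l with h | h <;> simp [h], fun k => ?_⟩
    have hk := hwin k
    have hle : (k : ℕ) + 1 - W ≤ (k : ℕ) + 1 := Nat.sub_le _ _
    rw [sum_filter_fin_eq_sum_Ico k (fun l => |w l|) (fun j => S (j + 1) - S j)
      (fun l => by rw [hSsucc, abs_of_nonneg (hw0 l), add_sub_cancel_left]),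
      Finset.sum_Ico_sub S hle] at hk
    rw [sum_filter_fin_eq_sum_Ico k (fun l => |B u l|)
      (fun j => ((⌊S (j + 1) + u⌋ : ℤ) : ℝ) - ((⌊S j + u⌋ : ℤ) : ℝ))
      (fun l => by
        rw [abs_of_nonneg (by rcases hB01 u l with h | h <;> simp [h])]),
      Finset.sum_Ico_sub (fun j => ((⌊S j + u⌋ : ℤ) : ℝ)) hle]
    have hfl : ⌊S ((k : ℕ) + 1) + u⌋ ≤ ⌊S ((k : ℕ) + 1 - W) + u⌋ + (g : ℤ) := by
      rw [← Int.floor_add_natCast]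
      exact Int.floor_mono (by linarith)
    have : ((⌊S ((k : ℕ) + 1) + u⌋ : ℤ) : ℝ) ≤ ⌊S ((k : ℕ) + 1 - W) + u⌋ + (g : ℝ) := by
      exact_mod_cast hfl
    linarith
  have hint : ∀ l, IntervalIntegrable (fun u => c l * B u l) volume 0 1 := fun l =>
    ((intervalIntegrable_floor_add _).sub (intervalIntegrable_floor_add _)).const_mul _
  have hval : ∫ u in (0:ℝ)..1, ∑ l, c l * B u l = ∑ l, c l * w l := by
    rw [intervalIntegral.integral_finsetSum fun l _ => hint l]
    refine Finset.sum_congr rfl fun l _ => ?_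
    rw [intervalIntegral.integral_const_mul, intervalIntegral.integral_sub
      (intervalIntegrable_floor_add _) (intervalIntegrable_floor_add _), integral_floor_add,
      integral_floor_add, hSsucc]
    ring
  by_contra! hcon
  have hlt : ∀ u, ∑ l, c l * B u l < ∑ l, c l * w l := fun u => hcon _ (hBDK u) (hB01 u)
  have hsum : IntervalIntegrable (fun u => ∑ l, c l * B u l) volume 0 1 := by
    simpa [Finset.sum_fn] using IntervalIntegrable.sum Finset.univ fun l _ => hint l
  have := intervalIntegral.intervalIntegral_pos_of_pos
    ((intervalIntegrable_const (c := ∑ l, c l * w l)).sub hsum)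
    (fun u => sub_pos.2 (hlt u)) zero_lt_one
  rw [intervalIntegral.integral_sub intervalIntegrable_const hsum, hval] at this
  simp at this

/-! ### The charging rate as a function of the frequency deviation -/

/-- The rate of change of the state of charge at base power `b`, regulation power `r`,
consumption `d` and frequency deviation `z`. -/
def chargeRate (ηp ηm b r d z : ℝ) : ℝ :=
  ηp * max (b + z * r) 0 - (1 / ηm) * max (-(b + z * r)) 0 - d

section ChargeRate

variable {ηp ηm b r d : ℝ}

theorem chargeRate_eq_min (hηp : ηp ∈ Ioc (0:ℝ) 1) (hηm : ηm ∈ Ioc (0:ℝ) 1) (z : ℝ) :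
    chargeRate ηp ηm b r d z = min (ηp * (b + z * r)) ((1 / ηm) * (b + z * r)) - d := by
  have h1 : 1 ≤ 1 / ηm := by rw [le_div_iff₀ hηm.1]; linarith [hηm.2]
  have h2 : ηp ≤ 1 / ηm := hηp.2.trans h1
  unfold chargeRate
  rcases le_total 0 (b + z * r) with h | h
  · rw [max_eq_left h, max_eq_right (by linarith), min_eq_left (by gcongr)]
    ring
  · rw [max_eq_right h, max_eq_left (by linarith),
      min_eq_right (mul_le_mul_of_nonpos_right h2 h)]
    ring

theorem continuous_chargeRate : Continuous (chargeRate ηp ηm b r d) := by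
  unfold chargeRate
  fun_prop

theorem chargeRate_mono (hηp : ηp ∈ Ioc (0:ℝ) 1) (hηm : ηm ∈ Ioc (0:ℝ) 1) (hr : 0 ≤ r) :
    Monotone (chargeRate ηp ηm b r d) := by
  intro z z' h
  have h0 : 0 < 1 / ηm := one_div_pos.2 hηm.1
  have h1 := hηp.1
  rw [chargeRate_eq_min hηp hηm, chargeRate_eq_min hηp hηm]
  gcongr

theorem concaveOn_chargeRate (hηp : ηp ∈ Ioc (0:ℝ) 1) (hηm : ηm ∈ Ioc (0:ℝ) 1) :
    ConcaveOn ℝ univ (chargeRate ηp ηm b r d) := by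
  have hlin : ∀ m : ℝ, ConcaveOn ℝ univ (fun z => m * (b + z * r)) := fun m =>
    ⟨convex_univ, fun x _ y _ s t _ _ hst => by
      simp only [smul_eq_mul]
      refine le_of_eq ?_
      linear_combination (m * b) * hst⟩
  have h := ((hlin ηp).inf (hlin (1 / ηm))).sub (convexOn_const d convex_univ)
  refine h.congr fun z _ => ?_
  simp [chargeRate_eq_min hηp hηm]

theorem chargeRate_ge (hηp : ηp ∈ Ioc (0:ℝ) 1) (hηm : ηm ∈ Ioc (0:ℝ) 1) (hr : 0 ≤ r)
    {z : ℝ} (hz : |z| ≤ 1) :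
    chargeRate ηp ηm b r d 0 -
        (chargeRate ηp ηm b r d 0 - chargeRate ηp ηm b r d (-1)) * |z| ≤
      chargeRate ηp ηm b r d z := by
  have h1 := chargeRate_mono (b := b) (d := d) hηp hηm hr (neg_abs_le z)
  have h2 := (concaveOn_chargeRate (b := b) (r := r) (d := d) hηp hηm).2 (mem_univ (0:ℝ))
    (mem_univ (-1:ℝ)) (sub_nonneg.2 hz) (abs_nonneg z) (by ring)
  simp only [smul_eq_mul, mul_zero, zero_add, mul_neg, mul_one] at h2
  linarith

theorem chargeRate_neg_of_zero_or_one {z : ℝ} (hz : z = 0 ∨ z = 1) :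
    chargeRate ηp ηm b r d (-z) = chargeRate ηp ηm b r d 0 -
      (chargeRate ηp ηm b r d 0 - chargeRate ηp ηm b r d (-1)) * z := by
  rcases hz with rfl | rfl <;> simp

theorem chargeRate_nonneg (hηp : ηp ∈ Ioc (0:ℝ) 1) (hb : 0 ≤ b) (hr : 0 ≤ r) {z : ℝ}
    (hz : 0 ≤ z) : 0 ≤ chargeRate ηp ηm b r 0 z := by
  have h : 0 ≤ b + z * r := by positivity
  have h1 := hηp.1
  unfold chargeRate
  rw [max_eq_left h, max_eq_right (by linarith)]
  simp only [mul_zero, sub_zero]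
  positivity

@[simp]
theorem chargeRate_zero_zero (z : ℝ) : chargeRate ηp ηm 0 0 d z = -d := by
  simp [chargeRate]

end ChargeRate

theorem intervalIntegrable_of_abs_le {f : ℝ → ℝ} {a b C : ℝ} (hf : Measurable f)
    (hab : a ≤ b) (h : ∀ s ∈ Icc a b, |f s| ≤ C) : IntervalIntegrable f volume a b := by
  rw [intervalIntegrable_iff_integrableOn_Icc_of_le hab]
  exact MeasureTheory.Measure.integrableOn_of_bounded (M := C) (by simp) hf.aestronglyMeasurable
    ((ae_restrict_iff' measurableSet_Icc).2 (ae_of_all _ h))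

section ChargeRateIntegral

variable {ηp ηm b r d : ℝ} {δ : ℝ → ℝ} {s t : ℝ}

theorem intervalIntegrable_chargeRate (hηp : ηp ∈ Ioc (0:ℝ) 1) (hηm : ηm ∈ Ioc (0:ℝ) 1)
    (hr : 0 ≤ r) (hδ : Measurable δ) (hst : s ≤ t) (h : ∀ u ∈ Icc s t, |δ u| ≤ 1) :
    IntervalIntegrable (fun u => chargeRate ηp ηm b r d (δ u)) volume s t := by
  refine intervalIntegrable_of_abs_le (continuous_chargeRate.measurable.comp hδ) hst
    (C := max |chargeRate ηp ηm b r d (-1)| |chargeRate ηp ηm b r d 1|) fun u hu => ?_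
  have h1 := abs_le.1 (h u hu)
  have hm := chargeRate_mono (b := b) (d := d) hηp hηm hr
  exact abs_le_max_abs_abs (hm h1.1) (hm h1.2)

theorem integral_chargeRate_le (hηp : ηp ∈ Ioc (0:ℝ) 1) (hηm : ηm ∈ Ioc (0:ℝ) 1)
    (hr : 0 ≤ r) (hδ : Measurable δ) (hst : s < t) (h : ∀ u ∈ Icc s t, |δ u| ≤ 1) :
    ∫ u in s..t, chargeRate ηp ηm b r d (δ u) ≤
      (t - s) * chargeRate ηp ηm b r d ((1 / (t - s)) * ∫ u in s..t, |δ u|) := by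
  have hts : 0 < t - s := sub_pos.2 hst
  have hm := chargeRate_mono (b := b) (d := d) hηp hηm hr
  have hδi : IntervalIntegrable (fun u => |δ u|) volume s t :=
    intervalIntegrable_of_abs_le (by fun_prop) hst.le (C := 1) (by simpa using h)
  set w := (1 / (t - s)) * ∫ u in s..t, |δ u| with hw
  have hlin : ∀ m : ℝ, (∀ z, chargeRate ηp ηm b r d z ≤ m * (b + z * r) - d) →
      ∫ u in s..t, chargeRate ηp ηm b r d (δ u) ≤ (t - s) * (m * (b + w * r) - d) := by
    intro m hle
    have hi : IntervalIntegrable (fun u => m * b - d + m * r * |δ u|) volume s t :=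
      intervalIntegrable_const.add (hδi.const_mul _)
    refine (intervalIntegral.integral_mono_on hst.le
      (intervalIntegrable_chargeRate hηp hηm hr hδ hst.le h) hi fun u _ => ?_).trans_eq ?_
    · refine (hm (le_abs_self (δ u))).trans ((hle _).trans_eq (by ring))
    · rw [intervalIntegral.integral_add intervalIntegrable_const (hδi.const_mul _),
        intervalIntegral.integral_const_mul]
      simp only [intervalIntegral.integral_const, smul_eq_mul, hw]
      field_simp
      ring
  rw [chargeRate_eq_min hηp hηm w]
  rcases min_choice (ηp * (b + w * r)) ((1 / ηm) * (b + w * r)) with hmin | hmin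
  · rw [hmin]
    exact hlin _ fun z => by
      rw [chargeRate_eq_min hηp hηm]
      linarith [min_le_left (ηp * (b + z * r)) ((1 / ηm) * (b + z * r))]
  · rw [hmin]
    exact hlin _ fun z => by
      rw [chargeRate_eq_min hηp hηm]
      linarith [min_le_right (ηp * (b + z * r)) ((1 / ηm) * (b + z * r))]

theorem integral_chargeRate_ge (hηp : ηp ∈ Ioc (0:ℝ) 1) (hηm : ηm ∈ Ioc (0:ℝ) 1)
    (hr : 0 ≤ r) (hδ : Measurable δ) (hst : s ≤ t) (h : ∀ u ∈ Icc s t, |δ u| ≤ 1) :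
    (t - s) * chargeRate ηp ηm b r d 0 -
        (chargeRate ηp ηm b r d 0 - chargeRate ηp ηm b r d (-1)) * (∫ u in s..t, |δ u|) ≤
      ∫ u in s..t, chargeRate ηp ηm b r d (δ u) := by
  have hδi : IntervalIntegrable (fun u => |δ u|) volume s t :=
    intervalIntegrable_of_abs_le (by fun_prop) hst (C := 1) (by simpa using h)
  have := intervalIntegral.integral_mono_on hst
    (intervalIntegrable_const.sub (hδi.const_mul _))
    (intervalIntegrable_chargeRate (b := b) (d := d) hηp hηm hr hδ hst h)
    fun u hu => chargeRate_ge (b := b) (d := d) hηp hηm hr (h u hu)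
  rw [intervalIntegral.integral_sub intervalIntegrable_const (hδi.const_mul _),
    intervalIntegral.integral_const_mul] at this
  simpa using this

end ChargeRateIntegral

/-! ### Lifted vectors and the trading grid -/

theorem exists_lift_eq {K : ℕ} (hK : 0 < K) (Δt t : ℝ) :
    ∃ k : Fin K, ∀ v : Fin K → ℝ, lift Δt v t = v k := by
  have h : min (⌊t / Δt⌋.toNat) (K - 1) < K := by omega
  exact ⟨⟨_, h⟩, fun v => dif_pos h⟩

theorem lift_eq {Δt : ℝ} {K : ℕ} (hΔt : 0 < Δt) (v : Fin K → ℝ) (k : Fin K) {s : ℝ}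
    (hs : s ∈ Ico ((k : ℝ) * Δt) (((k : ℝ) + 1) * Δt)) : lift Δt v s = v k := by
  have hfl : ⌊s / Δt⌋ = ((k : ℕ) : ℤ) := by
    rw [Int.floor_eq_iff, le_div_iff₀ hΔt, div_lt_iff₀ hΔt]
    simpa using hs
  have hk := k.2
  have hmin : min (⌊s / Δt⌋.toNat) (K - 1) = k := by
    rw [hfl, Int.toNat_natCast]
    omega
  unfold lift
  simp only [hmin, k.2, dif_pos]

theorem lift_grid {Δt : ℝ} {K : ℕ} (hΔt : 0 < Δt) (v : Fin K → ℝ) (k : Fin K) :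
    lift Δt v ((k : ℝ) * Δt) = v k :=
  lift_eq hΔt v k ⟨le_rfl, by linarith⟩

theorem measurable_lift {Δt : ℝ} {K : ℕ} (v : Fin K → ℝ) : Measurable (lift Δt v) := by
  have h : lift Δt v = (fun n : ℕ => if h : min n (K - 1) < K then v ⟨min n (K - 1), h⟩ else 0) ∘
      (fun m : ℤ => m.toNat) ∘ fun t : ℝ => ⌊t / Δt⌋ := rfl
  rw [h]
  exact measurable_from_top.comp (measurable_from_top.comp
    (Int.measurable_floor.comp (measurable_id.div_const Δt)))

theorem abs_lift_le {Δt : ℝ} {K : ℕ} {v : Fin K → ℝ} {C : ℝ} (hC : 0 ≤ C)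
    (hv : ∀ l, |v l| ≤ C) (t : ℝ) : |lift Δt v t| ≤ C := by
  unfold lift
  split_ifs
  · exact hv _
  · simpa using hC

theorem exists_grid_cell {Δt : ℝ} {K : ℕ} (hΔt : 0 < Δt) (hK : 0 < K) {t : ℝ}
    (ht : t ∈ Icc (0:ℝ) (K * Δt)) :
    ∃ k : Fin K, t ∈ Icc ((k : ℝ) * Δt) (((k : ℝ) + 1) * Δt) := by
  rcases ht.2.eq_or_lt with h | h
  · refine ⟨⟨K - 1, by omega⟩, ?_⟩
    simp only [Nat.cast_sub (Nat.succ_le_of_lt hK), Nat.cast_succ, Nat.cast_zero, h]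
    constructor <;> nlinarith
  · have h0 : 0 ≤ t / Δt := div_nonneg ht.1 hΔt.le
    refine ⟨⟨⌊t / Δt⌋₊, (Nat.floor_lt h0).2 ((div_lt_iff₀ hΔt).2 h)⟩, ?_, ?_⟩
    · exact (le_div_iff₀ hΔt).1 (Nat.floor_le h0)
    · exact ((div_lt_iff₀ hΔt).1 (Nat.lt_floor_add_one _)).le

theorem grid_cell_subset {Δt : ℝ} {K : ℕ} (hΔt : 0 < Δt) (k : Fin K) :
    Icc ((k : ℝ) * Δt) (((k : ℝ) + 1) * Δt) ⊆ Icc (0:ℝ) (K * Δt) := by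
  have hk : ((k : ℝ) + 1) ≤ K := by exact_mod_cast k.2
  exact Icc_subset_Icc (by positivity) (by gcongr)

/-! ### Comparison of the uncertainty sets -/

theorem abs_le_one_of_mem_Dset {T Γ γ : ℝ} {δ : ℝ → ℝ} (hδ : δ ∈ Dset T Γ γ) {s : ℝ}
    (hs : s ∈ Icc (0:ℝ) T) : |δ s| ≤ 1 :=
  abs_le.2 (hδ.2.1 s hs)

theorem neg_mem_DK {K W g : ℕ} {v : Fin K → ℝ} (hv : v ∈ DK K W g) : -v ∈ DK K W g := by
  simpa [DK] using hv

theorem single_mem_DK {K W g : ℕ} (hg : 0 < g) (k : Fin K) {z : ℝ} (hz : |z| ≤ 1) :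
    Pi.single k z ∈ DK K W g := by
  have habs : ∀ l, |(Pi.single k z : Fin K → ℝ) l| = (Pi.single k |z| : Fin K → ℝ) l := by
    intro l
    rcases eq_or_ne l k with rfl | h <;> simp [*]
  have hnn : ∀ l, 0 ≤ (Pi.single k |z| : Fin K → ℝ) l := fun l => by
    rw [← habs]; exact abs_nonneg _
  have hg' : (1:ℝ) ≤ g := by exact_mod_cast hg
  have hsum : ∑ l, (Pi.single k |z| : Fin K → ℝ) l = |z| := by simp
  refine ⟨fun l => ?_, fun j => ?_⟩
  · rw [habs]
    exact (Finset.single_le_sum (fun i _ => hnn i) (Finset.mem_univ l)).trans (hsum.trans_le hz)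
  · simp only [habs]
    exact (Finset.sum_le_univ_sum_of_nonneg hnn).trans (by linarith)

theorem avg_abs_mem_DKplus {Δt : ℝ} {K W g : ℕ} (hΔt : 0 < Δt) {δ : ℝ → ℝ}
    (hδ : δ ∈ Dset (K * Δt) (W * Δt) (g * Δt)) :
    avg Δt K (fun s => |δ s|) ∈ DKplus K W g := by
  have hcell : ∀ k : Fin K, (k : ℝ) * Δt ≤ ((k : ℝ) + 1) * Δt := fun k => by linarith
  have hint : ∀ k : Fin K,
      IntervalIntegrable (fun s => |δ s|) volume ((k : ℝ) * Δt) (((k : ℝ) + 1) * Δt) := fun k =>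
    intervalIntegrable_of_abs_le (C := 1) (by have := hδ.1; fun_prop) (hcell k) fun s hs => by
      simpa using abs_le_one_of_mem_Dset hδ (grid_cell_subset hΔt k hs)
  have hnn : ∀ l, 0 ≤ avg Δt K (fun s => |δ s|) l := fun l =>
    mul_nonneg (by positivity) (intervalIntegral.integral_nonneg (hcell l) fun _ _ => abs_nonneg _)
  refine ⟨⟨fun l => ?_, fun k => ?_⟩, hnn⟩
  · rw [abs_of_nonneg (hnn l)]
    have := intervalIntegral.integral_mono_on (hcell l) (hint l)
      (intervalIntegrable_const (c := (1:ℝ)))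
      fun s hs => abs_le_one_of_mem_Dset hδ (grid_cell_subset hΔt l hs)
    simp only [intervalIntegral.integral_const, smul_eq_mul] at this
    rw [avg, one_div, inv_mul_le_iff₀ hΔt]
    linarith
  · have hk : ((k : ℝ) + 1) ≤ K := by exact_mod_cast k.2
    rw [sum_filter_fin_eq_sum_Ico k _
      (fun j => (1 / Δt) * ∫ s in ((j : ℝ) * Δt)..(((j + 1 : ℕ) : ℝ) * Δt), |δ s|)
      (fun l => by rw [abs_of_nonneg (hnn l), avg, Nat.cast_succ]), ← Finset.mul_sum,
      intervalIntegral.sum_integral_adjacent_intervals_Ico (a := fun j : ℕ => (j : ℝ) * Δt)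
        (Nat.sub_le _ _)
        (fun j hj => by
          have := hint ⟨j, by have := hj.2; omega⟩
          simpa using this)]
    have hw := hδ.2.2 (((k : ℝ) + 1) * Δt) ⟨by positivity, by gcongr⟩
    have hmax : max (((k : ℝ) + 1) * Δt - W * Δt) 0 = (((k : ℕ) + 1 - W : ℕ) : ℝ) * Δt := by
      rcases le_total W ((k : ℕ) + 1) with h | h
      · have h' : (W : ℝ) ≤ (k : ℝ) + 1 := by exact_mod_cast h
        rw [max_eq_left (by nlinarith), Nat.cast_sub h]
        push_cast
        ring
      · have h' : (k : ℝ) + 1 ≤ W := by exact_mod_cast h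
        rw [max_eq_right (by nlinarith), Nat.sub_eq_zero_of_le h]
        simp
    rw [hmax] at hw
    rw [one_div, inv_mul_le_iff₀ hΔt, Nat.cast_succ, mul_comm Δt]
    exact hw

theorem integral_abs_lift_of_subset_cell {Δt : ℝ} {K : ℕ} (hΔt : 0 < Δt) (v : Fin K → ℝ)
    (k : Fin K) {s t : ℝ} (hs : (k : ℝ) * Δt ≤ s) (hst : s ≤ t)
    (ht : t ≤ ((k : ℝ) + 1) * Δt) : ∫ u in s..t, |lift Δt v u| = (t - s) * |v k| := by
  rw [intervalIntegral.integral_congr_Ioo_of_le (g := fun _ => |v k|) hst fun u hu => by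
    simp only [lift_eq hΔt v k ⟨hs.trans hu.1.le, hu.2.trans_le ht⟩]]
  simp

theorem lift_mem_Dset {Δt : ℝ} {K W g : ℕ} (hΔt : 0 < Δt) (hW : 0 < W) (hK : 0 < K)
    {v : Fin K → ℝ} (hv : v ∈ DK K W g) :
    lift Δt v ∈ Dset (K * Δt) (W * Δt) (g * Δt) := by
  refine ⟨measurable_lift v, fun t _ => abs_le.1 (abs_lift_le zero_le_one hv.1 t), fun t ht => ?_⟩
  have hint : ∀ a b, IntervalIntegrable (fun u => |lift Δt v u|) volume a b := by
    intro a b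
    have hm : Measurable fun u => |lift Δt v u| := by
      have := measurable_lift (Δt := Δt) v
      fun_prop
    have hle : ∀ a b : ℝ, a ≤ b → IntervalIntegrable (fun u => |lift Δt v u|) volume a b :=
      fun a b hab => intervalIntegrable_of_abs_le hm hab (C := 1) fun s _ => by
        simpa using abs_lift_le zero_le_one hv.1 s
    rcases le_total a b with h | h
    · exact hle a b h
    · exact (hle b a h).symm
  have hgrid : ∀ k : Fin K, ∫ u in ((((k : ℕ) + 1 - W : ℕ) : ℝ) * Δt)..(((k : ℝ) + 1) * Δt),
      |lift Δt v u| ≤ g * Δt := by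
    intro k
    have hk := hv.2 k
    rw [sum_filter_fin_eq_sum_Ico k _
      (fun j => (1 / Δt) * ∫ s in ((j : ℝ) * Δt)..(((j + 1 : ℕ) : ℝ) * Δt), |lift Δt v s|)
      (fun l => by
        rw [Nat.cast_succ, integral_abs_lift_of_subset_cell hΔt v l le_rfl (by linarith) le_rfl]
        field_simp
        ring), ← Finset.mul_sum,
      intervalIntegral.sum_integral_adjacent_intervals_Ico (a := fun j : ℕ => (j : ℝ) * Δt)
        (Nat.sub_le _ _) (fun j _ => hint _ _), one_div, inv_mul_le_iff₀ hΔt, Nat.cast_succ,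
      mul_comm Δt] at hk
    exact hk
  obtain ⟨k, hkt⟩ := exists_grid_cell hΔt hK ht
  rcases lt_or_ge (k : ℕ) W with hkW | hkW
  · have h1 := hgrid k
    rw [Nat.sub_eq_zero_of_le hkW, Nat.cast_zero, zero_mul] at h1
    refine le_trans ?_ h1
    exact intervalIntegral.integral_mono_interval (le_max_right _ _)
      (max_le (by have := mul_pos (Nat.cast_pos.2 hW : (0:ℝ) < W) hΔt; linarith) ht.1) hkt.2
      (ae_of_all _ fun _ => abs_nonneg _) (hint _ _)
  · obtain ⟨m, hm⟩ := Nat.exists_eq_add_of_le hkW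
    have hk2 := k.2
    set j : Fin K := ⟨m, by omega⟩ with hj
    set k' : Fin K := ⟨(k : ℕ) - 1, by omega⟩ with hk'
    have hkm : (k : ℝ) = W + m := by exact_mod_cast hm
    have hWle : (1 : ℝ) ≤ W := by exact_mod_cast hW
    have h1 := hgrid k
    have h2 := hgrid k'
    rw [show (k : ℕ) + 1 - W = m + 1 by omega, Nat.cast_succ, hkm] at h1
    rw [show (k' : ℕ) + 1 - W = m by simp only [hk']; omega,
      show ((k' : ℕ) : ℝ) + 1 = W + m by
        rw [← hkm, hk']; simp [Nat.cast_sub (by omega : 1 ≤ (k : ℕ))]] at h2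
    rw [hkm] at hkt
    have hmax : max (t - W * Δt) 0 = t - W * Δt := by
      have : (0:ℝ) ≤ m * Δt := by positivity
      exact max_eq_left (by linarith [hkt.1])
    rw [hmax]
    have e1 := intervalIntegral.integral_add_adjacent_intervals
      (hint (m * Δt) ((m + 1) * Δt)) (hint ((m + 1) * Δt) ((W + m) * Δt))
    have e2 := intervalIntegral.integral_add_adjacent_intervals
      (hint ((m + 1) * Δt) ((W + m) * Δt)) (hint ((W + m) * Δt) ((W + m + 1) * Δt))
    have e3 := intervalIntegral.integral_add_adjacent_intervals
      (hint (t - W * Δt) ((m + 1) * Δt)) (hint ((m + 1) * Δt) ((W + m) * Δt))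
    have e4 := intervalIntegral.integral_add_adjacent_intervals
      (hint (t - W * Δt) ((W + m) * Δt)) (hint ((W + m) * Δt) t)
    have f1 := integral_abs_lift_of_subset_cell hΔt v j (s := m * Δt) (t := (m + 1) * Δt)
      le_rfl (by linarith) le_rfl
    have f2 := integral_abs_lift_of_subset_cell hΔt v k (s := (W + m) * Δt)
      (t := (W + m + 1) * Δt) (by rw [hkm]) (by linarith) (by rw [hkm])
    have f3 := integral_abs_lift_of_subset_cell hΔt v j (s := t - W * Δt) (t := (m + 1) * Δt)
      (by change (m : ℝ) * Δt ≤ _; linarith [hkt.1]) (by linarith [hkt.2]) le_rfl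
    have f4 := integral_abs_lift_of_subset_cell hΔt v k (s := (W + m) * Δt) (t := t)
      (by rw [hkm]) hkt.1 (by rw [hkm]; exact hkt.2)
    set θ := (t - (W + m) * Δt) / Δt with hθ
    have hθ0 : 0 ≤ θ := div_nonneg (by linarith [hkt.1]) hΔt.le
    have hθ1 : 0 ≤ 1 - θ := by
      rw [hθ, sub_nonneg, div_le_one hΔt]
      linarith [hkt.2]
    have hθt : t = (W + m) * Δt + θ * Δt := by
      rw [hθ]
      field_simp
      ring
    have hA := mul_le_mul_of_nonneg_left h1 hθ0
    have hB := mul_le_mul_of_nonneg_left h2 hθ1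
    rw [← e4, ← e3, f3, f4]
    rw [← e2, f2] at hA
    rw [← e1, f1] at hB
    have g3 : (m + 1) * Δt - (t - W * Δt) = (1 - θ) * Δt := by rw [hθt]; ring
    have g4 : t - (W + m) * Δt = θ * Δt := by rw [hθt]; ring
    rw [g3, g4]
    linarith

/-! ### Comparison of the states of charge -/

section StateOfCharge

variable {Δt ηp ηm : ℝ} {K : ℕ} {xb xr d : Fin K → ℝ} {δ : ℝ → ℝ} {y0 : ℝ}

theorem socIntegrand_lift_eq (hΔt : 0 < Δt) (k : Fin K) {s : ℝ}
    (hs : s ∈ Ico ((k : ℝ) * Δt) (((k : ℝ) + 1) * Δt)) :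
    socIntegrand ηp ηm (lift Δt xb) (lift Δt xr) δ (lift Δt d) s =
      chargeRate ηp ηm (xb k) (xr k) (d k) (δ s) := by
  simp only [socIntegrand, chargeRate, lift_eq hΔt _ k hs]

theorem integral_socIntegrand_of_subset_cell (hΔt : 0 < Δt) (k : Fin K) {s t : ℝ}
    (hs : (k : ℝ) * Δt ≤ s) (hst : s ≤ t) (ht : t ≤ ((k : ℝ) + 1) * Δt) :
    ∫ u in s..t, socIntegrand ηp ηm (lift Δt xb) (lift Δt xr) δ (lift Δt d) u =
      ∫ u in s..t, chargeRate ηp ηm (xb k) (xr k) (d k) (δ u) :=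
  intervalIntegral.integral_congr_Ioo_of_le hst fun _ hu =>
    socIntegrand_lift_eq hΔt k ⟨hs.trans hu.1.le, hu.2.trans_le ht⟩

theorem soc_zero {xb xr d : ℝ → ℝ} : soc ηp ηm xb xr δ d y0 0 = y0 := by
  simp [soc]

theorem ysoc_succ {v : Fin K → ℝ} (k : Fin K) :
    ysoc Δt ηp ηm xb xr v d y0 (k + 1) = ysoc Δt ηp ηm xb xr v d y0 k +
      Δt * chargeRate ηp ηm (xb k) (xr k) (d k) (v k) := by
  unfold ysoc
  rw [sum_filter_lt_succ k.2, mul_add, ← add_assoc]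
  rfl

theorem ysoc_zero {v : Fin K → ℝ} : ysoc Δt ηp ηm xb xr v d y0 0 = y0 := by
  simp [ysoc]

variable (hΔt : 0 < Δt) (hηp : ηp ∈ Ioc (0:ℝ) 1) (hηm : ηm ∈ Ioc (0:ℝ) 1)
  (hxr : ∀ l, 0 ≤ xr l) (hδ : Measurable δ) (hδ1 : ∀ s ∈ Icc (0:ℝ) (K * Δt), |δ s| ≤ 1)

include hΔt hηp hηm hxr hδ hδ1

theorem intervalIntegrable_chargeRate_of_subset_cell (k : Fin K) {s t : ℝ}
    (hs : (k : ℝ) * Δt ≤ s) (hst : s ≤ t) (ht : t ≤ ((k : ℝ) + 1) * Δt) :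
    IntervalIntegrable (fun u => chargeRate ηp ηm (xb k) (xr k) (d k) (δ u)) volume s t :=
  intervalIntegrable_chargeRate hηp hηm (hxr k) hδ hst fun u hu =>
    hδ1 u (grid_cell_subset hΔt k ⟨hs.trans hu.1, hu.2.trans ht⟩)

theorem intervalIntegrable_socIntegrand_of_subset_cell (k : Fin K) {s t : ℝ}
    (hs : (k : ℝ) * Δt ≤ s) (hst : s ≤ t) (ht : t ≤ ((k : ℝ) + 1) * Δt) :
    IntervalIntegrable (socIntegrand ηp ηm (lift Δt xb) (lift Δt xr) δ (lift Δt d))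
      volume s t := by
  refine (intervalIntegrable_chargeRate_of_subset_cell (xb := xb) (d := d)
    hΔt hηp hηm hxr hδ hδ1 k hs hst ht).congr_uIoo fun u hu => ?_
  rw [uIoo_of_le hst] at hu
  exact (socIntegrand_lift_eq hΔt k ⟨hs.trans hu.1.le, hu.2.trans_le ht⟩).symm

theorem soc_eq_add_integral_chargeRate (k : Fin K) {t : ℝ}
    (ht : t ∈ Icc ((k : ℝ) * Δt) (((k : ℝ) + 1) * Δt)) :
    soc ηp ηm (lift Δt xb) (lift Δt xr) δ (lift Δt d) y0 t =
      soc ηp ηm (lift Δt xb) (lift Δt xr) δ (lift Δt d) y0 (k * Δt) +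
        ∫ u in ((k : ℝ) * Δt)..t, chargeRate ηp ηm (xb k) (xr k) (d k) (δ u) := by
  have hgrid : IntervalIntegrable (socIntegrand ηp ηm (lift Δt xb) (lift Δt xr) δ (lift Δt d))
      volume 0 (k * Δt) := by
    have := IntervalIntegrable.trans_iterate (a := fun j : ℕ => (j : ℝ) * Δt) (n := k)
      (μ := volume) (f := socIntegrand ηp ηm (lift Δt xb) (lift Δt xr) δ (lift Δt d))
      fun j hj => by
        have := intervalIntegrable_socIntegrand_of_subset_cell (xb := xb) (d := d)
          hΔt hηp hηm hxr hδ hδ1 ⟨j, hj.trans k.2⟩ le_rfl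
          (by simp only; linarith) le_rfl
        simpa using this
    simpa using this
  rw [soc, soc, ← integral_socIntegrand_of_subset_cell hΔt k le_rfl ht.1 ht.2, add_assoc,
    intervalIntegral.integral_add_adjacent_intervals hgrid
      (intervalIntegrable_socIntegrand_of_subset_cell hΔt hηp hηm hxr hδ hδ1 k le_rfl ht.1 ht.2)]

theorem soc_grid_succ (k : Fin K) :
    soc ηp ηm (lift Δt xb) (lift Δt xr) δ (lift Δt d) y0 (((k : ℝ) + 1) * Δt) =
      soc ηp ηm (lift Δt xb) (lift Δt xr) δ (lift Δt d) y0 (k * Δt) +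
        ∫ u in ((k : ℝ) * Δt)..(((k : ℝ) + 1) * Δt),
          chargeRate ηp ηm (xb k) (xr k) (d k) (δ u) :=
  soc_eq_add_integral_chargeRate hΔt hηp hηm hxr hδ hδ1 k ⟨by linarith, le_rfl⟩

theorem soc_grid_le_ysoc {k : ℕ} (hk : k ≤ K) :
    soc ηp ηm (lift Δt xb) (lift Δt xr) δ (lift Δt d) y0 (k * Δt) ≤
      ysoc Δt ηp ηm xb xr (avg Δt K fun s => |δ s|) d y0 k := by
  induction k with
  | zero => simp [soc_zero, ysoc_zero]
  | succ k ih =>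
    have h1 := soc_grid_succ (xb := xb) (d := d) (y0 := y0) hΔt hηp hηm hxr hδ hδ1 ⟨k, hk⟩
    have h2 := ysoc_succ (Δt := Δt) (ηp := ηp) (ηm := ηm) (xb := xb) (xr := xr) (d := d)
      (y0 := y0) (v := avg Δt K fun s => |δ s|) ⟨k, hk⟩
    have h3 := integral_chargeRate_le (b := xb ⟨k, hk⟩) (d := d ⟨k, hk⟩) hηp hηm (hxr ⟨k, hk⟩)
      hδ (s := (k : ℝ) * Δt) (t := ((k : ℝ) + 1) * Δt) (by linarith)
      fun u hu => hδ1 u (grid_cell_subset hΔt ⟨k, hk⟩ hu)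
    have h4 : ((k : ℝ) + 1) * Δt - k * Δt = Δt := by ring
    rw [h4] at h3
    rw [Nat.cast_succ]
    have := ih (by omega)
    simp only at h1 h2
    rw [h1, h2]
    exact add_le_add this h3

theorem le_soc_grid {k : ℕ} (hk : k ≤ K) :
    y0 + Δt * ∑ l ∈ Finset.univ.filter (fun l : Fin K => (l : ℕ) < k),
        (chargeRate ηp ηm (xb l) (xr l) (d l) 0 -
          (chargeRate ηp ηm (xb l) (xr l) (d l) 0 - chargeRate ηp ηm (xb l) (xr l) (d l) (-1)) *
            avg Δt K (fun s => |δ s|) l) ≤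
      soc ηp ηm (lift Δt xb) (lift Δt xr) δ (lift Δt d) y0 (k * Δt) := by
  induction k with
  | zero => simp [soc_zero]
  | succ k ih =>
    have h1 := soc_grid_succ (xb := xb) (d := d) (y0 := y0) hΔt hηp hηm hxr hδ hδ1 ⟨k, hk⟩
    have h3 := integral_chargeRate_ge (b := xb ⟨k, hk⟩) (d := d ⟨k, hk⟩) hηp hηm (hxr ⟨k, hk⟩)
      hδ (s := (k : ℝ) * Δt) (t := ((k : ℝ) + 1) * Δt) (by linarith)
      fun u hu => hδ1 u (grid_cell_subset hΔt ⟨k, hk⟩ hu)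
    have h4 : ((k : ℝ) + 1) * Δt - k * Δt = Δt := by ring
    have h5 : ∫ u in ((k : ℝ) * Δt)..(((k : ℝ) + 1) * Δt), |δ u| =
        Δt * avg Δt K (fun s => |δ s|) ⟨k, hk⟩ := by
      rw [avg]
      field_simp
    rw [h4, h5] at h3
    rw [Nat.cast_succ, sum_filter_lt_succ hk]
    have := ih (by omega)
    simp only at h1
    rw [h1]
    linarith

omit hδ hδ1 in
theorem soc_lift_grid {v : Fin K → ℝ} (hv : ∀ l, |v l| ≤ 1) {k : ℕ} (hk : k ≤ K) :
    soc ηp ηm (lift Δt xb) (lift Δt xr) (lift Δt v) (lift Δt d) y0 (k * Δt) =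
      ysoc Δt ηp ηm xb xr v d y0 k := by
  induction k with
  | zero => simp [soc_zero, ysoc_zero]
  | succ k ih =>
    have h1 := soc_grid_succ (xb := xb) (d := d) (y0 := y0) hΔt hηp hηm hxr
      (measurable_lift (Δt := Δt) v) (fun s _ => abs_lift_le zero_le_one hv s) ⟨k, hk⟩
    have h2 := ysoc_succ (Δt := Δt) (ηp := ηp) (ηm := ηm) (xb := xb) (xr := xr) (d := d)
      (y0 := y0) (v := v) ⟨k, hk⟩
    have h3 : ∫ u in ((k : ℝ) * Δt)..(((k : ℝ) + 1) * Δt),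
        chargeRate ηp ηm (xb ⟨k, hk⟩) (xr ⟨k, hk⟩) (d ⟨k, hk⟩) (lift Δt v u) =
        Δt * chargeRate ηp ηm (xb ⟨k, hk⟩) (xr ⟨k, hk⟩) (d ⟨k, hk⟩) (v ⟨k, hk⟩) := by
      rw [intervalIntegral.integral_congr_Ioo_of_le
        (g := fun _ => chargeRate ηp ηm (xb ⟨k, hk⟩) (xr ⟨k, hk⟩) (d ⟨k, hk⟩) (v ⟨k, hk⟩))
        (by linarith) fun u hu => by
          simp only [lift_eq hΔt v ⟨k, hk⟩ ⟨hu.1.le, hu.2⟩]]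
      rw [intervalIntegral.integral_const, smul_eq_mul]
      ring
    simp only at h1 h2
    rw [Nat.cast_succ, h1, h2, h3, ih (by omega)]

end StateOfCharge

theorem exists_zero_one_mem_DK_filter {K W g : ℕ} {w : Fin K → ℝ} (hw : w ∈ DKplus K W g)
    (c : Fin K → ℝ) (n : ℕ) :
    ∃ b ∈ DK K W g, (∀ l, b l = 0 ∨ b l = 1) ∧
      ∑ l ∈ Finset.univ.filter (fun l : Fin K => (l : ℕ) < n), c l * w l ≤
        ∑ l ∈ Finset.univ.filter (fun l : Fin K => (l : ℕ) < n), c l * b l := by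
  obtain ⟨b, hb, hb01, hle⟩ := exists_zero_one_mem_DK hw fun l => if (l : ℕ) < n then c l else 0
  exact ⟨b, hb, hb01, by simpa [Finset.sum_filter, ite_mul] using hle⟩

section Discretization

variable {Δt ηp ηm : ℝ} {K W g : ℕ} {xb xr d : Fin K → ℝ} {y0 : ℝ}

theorem ysoc_neg_of_zero_one {b : Fin K → ℝ} (hb : ∀ l, b l = 0 ∨ b l = 1) (k : ℕ) :
    ysoc Δt ηp ηm xb xr (-b) d y0 k =
      y0 + Δt * ∑ l ∈ Finset.univ.filter (fun l : Fin K => (l : ℕ) < k),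
        (chargeRate ηp ηm (xb l) (xr l) (d l) 0 -
          (chargeRate ηp ηm (xb l) (xr l) (d l) 0 - chargeRate ηp ηm (xb l) (xr l) (d l) (-1)) *
            b l) := by
  unfold ysoc
  congr 2
  exact Finset.sum_congr rfl fun l _ => chargeRate_neg_of_zero_or_one (hb l)

theorem exists_ysoc_le_soc_grid (hΔt : 0 < Δt) (hηp : ηp ∈ Ioc (0:ℝ) 1)
    (hηm : ηm ∈ Ioc (0:ℝ) 1) (hxr : ∀ l, 0 ≤ xr l) {δ : ℝ → ℝ}
    (hδ : δ ∈ Dset (K * Δt) (W * Δt) (g * Δt)) {k : ℕ} (hk : k ≤ K) :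
    ∃ v ∈ DK K W g, ysoc Δt ηp ηm xb xr v d y0 k ≤
      soc ηp ηm (lift Δt xb) (lift Δt xr) δ (lift Δt d) y0 (k * Δt) := by
  obtain ⟨b, hb, hb01, hle⟩ := exists_zero_one_mem_DK_filter (avg_abs_mem_DKplus hΔt hδ)
    (fun l => chargeRate ηp ηm (xb l) (xr l) (d l) 0 -
      chargeRate ηp ηm (xb l) (xr l) (d l) (-1)) k
  refine ⟨-b, neg_mem_DK hb, le_trans ?_ (le_soc_grid hΔt hηp hηm hxr hδ.1
    (fun s hs => abs_le_one_of_mem_Dset hδ hs) hk)⟩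
  rw [ysoc_neg_of_zero_one hb01, Finset.sum_sub_distrib, Finset.sum_sub_distrib]
  gcongr

/-- Within a trading interval in which the vehicle may be discharged, the state of charge is
bounded below by a discrete one at an endpoint of the interval. -/
theorem exists_ysoc_le_soc (hΔt : 0 < Δt) (hηp : ηp ∈ Ioc (0:ℝ) 1)
    (hηm : ηm ∈ Ioc (0:ℝ) 1) (hxr : ∀ l, 0 ≤ xr l) {δ : ℝ → ℝ}
    (hδ : δ ∈ Dset (K * Δt) (W * Δt) (g * Δt)) (k : Fin K) {t : ℝ}
    (ht : t ∈ Icc ((k : ℝ) * Δt) (((k : ℝ) + 1) * Δt))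
    (h0 : 0 ≤ chargeRate ηp ηm (xb k) (xr k) (d k) 0)
    (hneg : chargeRate ηp ηm (xb k) (xr k) (d k) (-1) < 0) :
    ∃ v ∈ DK K W g, ∃ n ≤ K, ysoc Δt ηp ηm xb xr v d y0 n ≤
      soc ηp ηm (lift Δt xb) (lift Δt xr) δ (lift Δt d) y0 t := by
  have hδ1 : ∀ s ∈ Icc (0:ℝ) (K * Δt), |δ s| ≤ 1 := fun s hs => abs_le_one_of_mem_Dset hδ hs
  set f : Fin K → ℝ → ℝ := fun l => chargeRate ηp ηm (xb l) (xr l) (d l) with hf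
  set w := avg Δt K fun s => |δ s| with hw
  obtain ⟨b, hb, hb01, hle⟩ := exists_zero_one_mem_DK_filter (avg_abs_mem_DKplus hΔt hδ)
    (fun l => if (l : ℕ) < k then f l 0 - f l (-1) else -f l (-1)) (k + 1)
  have hsum : ∀ z : Fin K → ℝ, ∑ l ∈ Finset.univ.filter (fun l : Fin K => (l : ℕ) < k),
      (if (l : ℕ) < k then f l 0 - f l (-1) else -f l (-1)) * z l =
      ∑ l ∈ Finset.univ.filter (fun l : Fin K => (l : ℕ) < k), (f l 0 - f l (-1)) * z l :=
    fun z => Finset.sum_congr rfl fun l hl => by rw [if_pos (Finset.mem_filter.1 hl).2]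
  rw [sum_filter_lt_succ k.2, sum_filter_lt_succ k.2, hsum, hsum] at hle
  simp only [lt_irrefl, if_false, Fin.eta] at hle
  have hint : ∀ s ∈ Icc ((k : ℝ) * Δt) (((k : ℝ) + 1) * Δt), |δ s| ≤ 1 := fun s hs =>
    hδ1 s (grid_cell_subset hΔt k hs)
  have habs : IntervalIntegrable (fun u => |δ u|) volume (k * Δt) (((k : ℝ) + 1) * Δt) :=
    intervalIntegrable_of_abs_le (by have := hδ.1; fun_prop) (by linarith) (C := 1)
      (by simpa using hint)
  have habs' : IntervalIntegrable (fun u => |δ u|) volume (k * Δt) t :=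
    intervalIntegrable_of_abs_le (by have := hδ.1; fun_prop) ht.1 (C := 1)
      fun s hs => by simpa using hint s ⟨hs.1, hs.2.trans ht.2⟩
  have hu1 : ∫ u in ((k : ℝ) * Δt)..t, |δ u| ≤ t - k * Δt := by
    have := intervalIntegral.integral_mono_on ht.1 habs' (intervalIntegrable_const (c := (1:ℝ)))
      fun s hs => hint s ⟨hs.1, hs.2.trans ht.2⟩
    simpa using this
  have hu2 : ∫ u in ((k : ℝ) * Δt)..t, |δ u| ≤ Δt * w k := by
    have := intervalIntegral.integral_mono_interval le_rfl ht.1 ht.2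
      (ae_of_all _ fun u => abs_nonneg (δ u)) habs
    refine this.trans_eq ?_
    rw [hw, avg]
    field_simp
  have hcell := integral_chargeRate_ge (b := xb k) (d := d k) hηp hηm (hxr k) hδ.1 ht.1
    fun s hs => hint s ⟨hs.1, hs.2.trans ht.2⟩
  have hgrid := le_soc_grid (xb := xb) (d := d) (y0 := y0) hΔt hηp hηm hxr hδ.1 hδ1 k.2.le
  have hsoc := soc_eq_add_integral_chargeRate (xb := xb) (d := d) (y0 := y0)
    hΔt hηp hηm hxr hδ.1 hδ1 k ht
  have hys := ysoc_neg_of_zero_one (Δt := Δt) (ηp := ηp) (ηm := ηm) (xb := xb) (xr := xr)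
    (d := d) (y0 := y0) hb01 k
  have hyk := ysoc_succ (Δt := Δt) (ηp := ηp) (ηm := ηm) (xb := xb) (xr := xr) (d := d)
    (y0 := y0) (v := -b) k
  change 0 ≤ f k 0 at h0
  change f k (-1) < 0 at hneg
  rw [Finset.sum_sub_distrib] at hgrid hys
  have e1 := mul_le_mul_of_nonneg_right hu1 h0
  have e2 := mul_le_mul_of_nonpos_right hu2 hneg.le
  have e3 := mul_le_mul_of_nonneg_left hle hΔt.le
  have key : ysoc Δt ηp ηm xb xr (-b) d y0 k + Δt * (f k (-1) * b k) ≤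
      soc ηp ηm (lift Δt xb) (lift Δt xr) δ (lift Δt d) y0 t := by
    linarith
  refine ⟨-b, neg_mem_DK hb, ?_⟩
  rcases hb01 k with hbk | hbk
  · refine ⟨k, k.2.le, ?_⟩
    simpa [hbk] using key
  · refine ⟨k + 1, k.2, ?_⟩
    rw [hyk, Pi.neg_apply, hbk]
    simpa [hbk] using key

end Discretization

/-! ### Feasible sets and penalties -/

section Equivalence

variable {Δt ηp ηm : ℝ} {K W g : ℕ} {xb xr d ybarp ybarm : Fin K → ℝ} {ylo yhi yl0 yu0 : ℝ}

theorem discFeasible_of_contFeasible (hΔt : 0 < Δt) (hW : 0 < W) (hK : 0 < K)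
    (hηp : ηp ∈ Ioc (0:ℝ) 1) (hηm : ηm ∈ Ioc (0:ℝ) 1) (hxr : ∀ l, 0 ≤ xr l)
    (h : contFeasible (K * Δt) (W * Δt) (g * Δt) Δt ηp ηm d ybarp ybarm ylo yhi yl0 yu0 xb xr) :
    discFeasible Δt ηp ηm W g d ybarp ybarm ylo yhi yl0 yu0 xb xr := by
  intro v hv
  have hlift := lift_mem_Dset hΔt hW hK hv
  have hgrid : ∀ k ≤ K, (k : ℝ) * Δt ∈ Icc (0:ℝ) (K * Δt) := fun k hk =>
    ⟨by positivity, by gcongr⟩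
  refine ⟨fun k => ?_, fun k hk y0 hy0 => ?_⟩
  · have := h _ hlift _ (hgrid k k.2.le)
    simp only [lift_grid hΔt _ k] at this
    exact ⟨this.1, this.2.1⟩
  · rw [← soc_lift_grid hΔt hηp hηm hxr hv.1 hk]
    exact (h _ hlift _ (hgrid k hk)).2.2 y0 hy0

theorem discFeasible.power_le (hg : 0 < g)
    (h : discFeasible Δt ηp ηm W g d ybarp ybarm ylo yhi yl0 yu0 xb xr) (k : Fin K) {z : ℝ}
    (hz : |z| ≤ 1) :
    max (xb k + z * xr k) 0 ≤ ybarp k ∧ max (-(xb k + z * xr k)) 0 ≤ ybarm k := by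
  simpa using (h _ (single_mem_DK hg k hz)).1 k

theorem discFeasible.soc_mem (hΔt : 0 < Δt) (hg : 0 < g) (hK : 0 < K)
    (hηp : ηp ∈ Ioc (0:ℝ) 1) (hηm : ηm ∈ Ioc (0:ℝ) 1) (hd : ∀ l, 0 ≤ d l)
    (hdrive : ∀ l, 0 < d l → ybarp l = 0) (hxb : ∀ l, 0 ≤ xb l) (hxr : ∀ l, 0 ≤ xr l)
    (h : discFeasible Δt ηp ηm W g d ybarp ybarm ylo yhi yl0 yu0 xb xr) {δ : ℝ → ℝ}
    (hδ : δ ∈ Dset (K * Δt) (W * Δt) (g * Δt)) {t : ℝ} (ht : t ∈ Icc (0:ℝ) (K * Δt))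
    {y0 : ℝ} (hy0 : y0 ∈ Icc yl0 yu0) :
    soc ηp ηm (lift Δt xb) (lift Δt xr) δ (lift Δt d) y0 t ∈ Icc ylo yhi := by
  have hδ1 : ∀ s ∈ Icc (0:ℝ) (K * Δt), |δ s| ≤ 1 := fun s hs => abs_le_one_of_mem_Dset hδ hs
  have havg := avg_abs_mem_DKplus hΔt hδ
  have hhi : ∀ n ≤ K,
      soc ηp ηm (lift Δt xb) (lift Δt xr) δ (lift Δt d) y0 (n * Δt) ≤ yhi := fun n hn =>
    (soc_grid_le_ysoc hΔt hηp hηm hxr hδ.1 hδ1 hn).trans ((h _ havg.1).2 n hn y0 hy0).2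
  have hlo : ∀ n ≤ K,
      ylo ≤ soc ηp ηm (lift Δt xb) (lift Δt xr) δ (lift Δt d) y0 (n * Δt) := fun n hn => by
    obtain ⟨v, hv, hle⟩ := exists_ysoc_le_soc_grid (xb := xb) (d := d) (y0 := y0)
      hΔt hηp hηm hxr hδ hn
    exact ((h v hv).2 n hn y0 hy0).1.trans hle
  obtain ⟨k, hkt⟩ := exists_grid_cell hΔt hK ht
  have hsoc := soc_eq_add_integral_chargeRate (xb := xb) (d := d) (y0 := y0)
    hΔt hηp hηm hxr hδ.1 hδ1 k hkt
  have hcell : ∀ s ∈ Icc ((k : ℝ) * Δt) t, |δ s| ≤ 1 := fun s hs =>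
    hδ1 s (grid_cell_subset hΔt k ⟨hs.1, hs.2.trans hkt.2⟩)
  rcases (hd k).eq_or_lt with hdk | hdk
  · constructor
    · by_cases hneg : chargeRate ηp ηm (xb k) (xr k) (d k) (-1) < 0
      · obtain ⟨v, hv, n, hn, hle⟩ := exists_ysoc_le_soc (y0 := y0) hΔt hηp hηm hxr hδ k hkt
          (by rw [← hdk]; exact chargeRate_nonneg hηp (hxb k) (hxr k) le_rfl) hneg
        exact ((h v hv).2 n hn y0 hy0).1.trans hle
      · have : 0 ≤ ∫ u in ((k : ℝ) * Δt)..t, chargeRate ηp ηm (xb k) (xr k) (d k) (δ u) :=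
          intervalIntegral.integral_nonneg hkt.1 fun u hu =>
            (not_lt.1 hneg).trans (chargeRate_mono hηp hηm (hxr k) (abs_le.1 (hcell u hu)).1)
        rw [hsoc]
        linarith [hlo k k.2.le]
    · have hmeas : Measurable fun u => |δ u| := by
        have := hδ.1
        fun_prop
      have hfull : ∀ s ∈ Icc ((k : ℝ) * Δt) (((k : ℝ) + 1) * Δt), |(|δ s|)| ≤ 1 := fun s hs => by
        simpa using hδ1 s (grid_cell_subset hΔt k hs)
      have h1 := intervalIntegral.integral_mono_on hkt.1
        (intervalIntegrable_chargeRate (b := xb k) (d := d k) hηp hηm (hxr k) hδ.1 hkt.1 hcell)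
        (intervalIntegrable_chargeRate (b := xb k) (d := d k) hηp hηm (hxr k) hmeas hkt.1
          fun s hs => hfull s ⟨hs.1, hs.2.trans hkt.2⟩)
        fun u _ => chargeRate_mono hηp hηm (hxr k) (le_abs_self (δ u))
      have h2 := intervalIntegral.integral_mono_interval le_rfl hkt.1 hkt.2
        (ae_of_all _ fun u => by
          rw [← hdk]
          exact chargeRate_nonneg hηp (hxb k) (hxr k) (abs_nonneg (δ u)))
        (intervalIntegrable_chargeRate (b := xb k) (d := d k) hηp hηm (hxr k) hmeas
          (by linarith) hfull)
      have h3 := integral_chargeRate_le (b := xb k) (d := d k) hηp hηm (hxr k) hmeas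
        (by linarith) hfull
      have h4 : (1 / (((k : ℝ) + 1) * Δt - k * Δt)) *
          ∫ u in ((k : ℝ) * Δt)..(((k : ℝ) + 1) * Δt), |(|δ u|)| =
          avg Δt K (fun s => |δ s|) k := by
        simp only [abs_abs, avg]
        ring_nf
      rw [h4, show ((k : ℝ) + 1) * Δt - k * Δt = Δt by ring] at h3
      have h5 := soc_grid_le_ysoc (xb := xb) (d := d) (y0 := y0) hΔt hηp hηm hxr hδ.1 hδ1 k.2.le
      have h6 := ((h _ havg.1).2 (k + 1) k.2 y0 hy0).2
      rw [ysoc_succ] at h6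
      rw [hsoc]
      linarith
  · have hpow := (h.power_le hg k (z := 1) (by simp)).1
    rw [hdrive k hdk, one_mul] at hpow
    have hle := (le_max_left _ _).trans hpow
    have hb0 : xb k = 0 := by linarith [hxb k, hxr k]
    have hr0 : xr k = 0 := by linarith [hxb k, hxr k]
    have hsucc := soc_grid_succ (xb := xb) (d := d) (y0 := y0) hΔt hηp hηm hxr hδ.1 hδ1 k
    have hlo' := hlo (k + 1) k.2
    rw [Nat.cast_succ] at hlo'
    simp only [hb0, hr0, chargeRate_zero_zero, intervalIntegral.integral_const, smul_eq_mul]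
      at hsoc hsucc
    have e1 : 0 ≤ (t - k * Δt) * d k := mul_nonneg (by linarith [hkt.1]) hdk.le
    have e2 : 0 ≤ (((k : ℝ) + 1) * Δt - t) * d k := mul_nonneg (by linarith [hkt.2]) hdk.le
    constructor
    · linarith
    · linarith [hhi k k.2.le]

theorem contFeasible_iff_discFeasible (hΔt : 0 < Δt) (hg : 0 < g) (hW : 0 < W) (hK : 0 < K)
    (hηp : ηp ∈ Ioc (0:ℝ) 1) (hηm : ηm ∈ Ioc (0:ℝ) 1) (hd : ∀ l, 0 ≤ d l)
    (hdrive : ∀ l, 0 < d l → ybarp l = 0) (hxb : ∀ l, 0 ≤ xb l) (hxr : ∀ l, 0 ≤ xr l) :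
    contFeasible (K * Δt) (W * Δt) (g * Δt) Δt ηp ηm d ybarp ybarm ylo yhi yl0 yu0 xb xr ↔
      discFeasible Δt ηp ηm W g d ybarp ybarm ylo yhi yl0 yu0 xb xr := by
  refine ⟨discFeasible_of_contFeasible hΔt hW hK hηp hηm hxr, fun h δ hδ t ht => ?_⟩
  obtain ⟨k, hk⟩ := exists_lift_eq hK Δt t
  obtain ⟨hp, hm⟩ := h.power_le hg k (abs_le_one_of_mem_Dset hδ ht)
  simp only [hk]
  exact ⟨hp, hm, fun y0 hy0 =>
    h.soc_mem hΔt hg hK hηp hηm hd hdrive hxb hxr hδ ht hy0⟩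

theorem sSup_eq_of_subset_of_forall_exists_le {s t : Set ℝ} (hst : s ⊆ t)
    (h : ∀ x ∈ t, ∃ y ∈ s, x ≤ y) : sSup t = sSup s := by
  have hub : upperBounds t = upperBounds s :=
    Subset.antisymm (upperBounds_mono_set hst) fun u hu x hx =>
      let ⟨_, hy, hxy⟩ := h x hx
      hxy.trans (hu hy)
  rcases s.eq_empty_or_nonempty with rfl | hs
  · have : t = ∅ := eq_empty_of_forall_notMem fun x hx => by simpa using h x hx
    rw [this]
  by_cases hb : BddAbove s
  · refine IsLUB.csSup_eq ?_ (hs.mono hst)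
    unfold IsLUB
    rw [hub]
    exact isLUB_csSup hs hb
  · have hb' : ¬ BddAbove t := fun hb' => hb (hb'.mono hst)
    rw [Real.sSup_of_not_bddAbove hb, Real.sSup_of_not_bddAbove hb']

theorem contPenalty_eq_discPenalty (hΔt : 0 < Δt) (hW : 0 < W) (hK : 0 < K)
    (hηp : ηp ∈ Ioc (0:ℝ) 1) (hηm : ηm ∈ Ioc (0:ℝ) 1) (hxr : ∀ l, 0 ≤ xr l)
    {ylh yuh pstar ystar : ℝ} (hpstar : 0 ≤ pstar) :
    contPenalty (K * Δt) (W * Δt) (g * Δt) Δt ηp ηm d ylh yuh pstar ystar xb xr =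
      discPenalty Δt ηp ηm W g d ylh yuh pstar ystar xb xr := by
  refine sSup_eq_of_subset_of_forall_exists_le ?_ ?_
  · rintro _ ⟨v, hv, y0, hy0, rfl⟩
    exact ⟨lift Δt v, lift_mem_Dset hΔt hW hK hv, y0, hy0, by
      rw [soc_lift_grid hΔt hηp hηm hxr hv.1 le_rfl]⟩
  · rintro _ ⟨δ, hδ, y0, hy0, rfl⟩
    obtain ⟨v, hv, hle⟩ := exists_ysoc_le_soc_grid (xb := xb) (d := d) (y0 := y0)
      hΔt hηp hηm hxr hδ le_rfl
    have hge := soc_grid_le_ysoc (xb := xb) (d := d) (y0 := y0) hΔt hηp hηm hxr hδ.1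
      (fun s hs => abs_le_one_of_mem_Dset hδ hs) le_rfl
    have hmax := abs_le_max_abs_abs (sub_le_sub_right hle ystar) (sub_le_sub_right hge ystar)
    rcases le_max_iff.1 hmax with hcase | hcase
    · exact ⟨_, ⟨v, hv, y0, hy0, rfl⟩, mul_le_mul_of_nonneg_left hcase hpstar⟩
    · exact ⟨_, ⟨_, (avg_abs_mem_DKplus hΔt hδ).1, y0, hy0, rfl⟩,
        mul_le_mul_of_nonneg_left hcase hpstar⟩

end Equivalence

/-- Theorem 1, lossless time discretization: the
continuous-time robust problem (R) and its discrete-time counterpart (R_K) have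
identical feasible sets and identical objective values at every feasible point;
in particular their optimal values coincide. -/
theorem stmt_11 (Δt : ℝ) (K W g Wh gh : ℕ) (hΔt : 0 < Δt)
    (hg : 0 < g) (hgW : g ≤ W) (hWK : W ≤ K)
    (hgh : 0 < gh) (hghWh : gh ≤ Wh) (hWhK : Wh ≤ K)
    (T Γ γ Γh γh : ℝ) (hT : T = K * Δt) (hΓ : Γ = W * Δt) (hγ : γ = g * Δt)
    (hΓh : Γh = Wh * Δt) (hγh : γh = gh * Δt)
    (ηp ηm : ℝ) (hηp : ηp ∈ Ioc (0:ℝ) 1) (hηm : ηm ∈ Ioc (0:ℝ) 1)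
    (d ybarp ybarm : Fin K → ℝ) (hd : ∀ l, 0 ≤ d l)
    (hybarp : ∀ l, 0 ≤ ybarp l) (hybarm : ∀ l, 0 ≤ ybarm l)
    (hdrive : ∀ l, 0 < d l → ybarp l = 0 ∧ ybarm l = 0)
    (ylo yhi : ℝ) (hy : ylo ≤ yhi) (ystar pstar : ℝ) (hpstar : 0 ≤ pstar)
    (yl0 yu0 : ℝ) (hy0 : yl0 ≤ yu0) (ylh yuh : ℝ) (hyh : ylh ≤ yuh)
    (pb pr : Fin K → ℝ)
    (XK : Set (Fin K → ℝ)) (hXK : ∀ v ∈ XK, ∀ l, 0 ≤ v l) :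
    (∀ xb ∈ XK, ∀ xr ∈ XK,
      (contFeasible T Γ γ Δt ηp ηm d ybarp ybarm ylo yhi yl0 yu0 xb xr ↔
        discFeasible Δt ηp ηm W g d ybarp ybarm ylo yhi yl0 yu0 xb xr) ∧
      Δt * (∑ k, (pb k * xb k - pr k * xr k)) +
          contPenalty T Γh γh Δt ηp ηm d ylh yuh pstar ystar xb xr =
        Δt * (∑ k, (pb k * xb k - pr k * xr k)) +
          discPenalty Δt ηp ηm Wh gh d ylh yuh pstar ystar xb xr) ∧
    sInf {v : ℝ | ∃ xb ∈ XK, ∃ xr ∈ XK,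
        contFeasible T Γ γ Δt ηp ηm d ybarp ybarm ylo yhi yl0 yu0 xb xr ∧
        v = Δt * (∑ k, (pb k * xb k - pr k * xr k)) +
          contPenalty T Γh γh Δt ηp ηm d ylh yuh pstar ystar xb xr} =
      sInf {v : ℝ | ∃ xb ∈ XK, ∃ xr ∈ XK,
        discFeasible Δt ηp ηm W g d ybarp ybarm ylo yhi yl0 yu0 xb xr ∧
        v = Δt * (∑ k, (pb k * xb k - pr k * xr k)) +
          discPenalty Δt ηp ηm Wh gh d ylh yuh pstar ystar xb xr} := by
  subst hT hΓ hγ hΓh hγh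
  have hW : 0 < W := hg.trans_le hgW
  have hK : 0 < K := hW.trans_le hWK
  have hpoint : ∀ xb ∈ XK, ∀ xr ∈ XK,
      (contFeasible (K * Δt) (W * Δt) (g * Δt) Δt ηp ηm d ybarp ybarm ylo yhi yl0 yu0 xb xr ↔
        discFeasible Δt ηp ηm W g d ybarp ybarm ylo yhi yl0 yu0 xb xr) ∧
      contPenalty (K * Δt) (Wh * Δt) (gh * Δt) Δt ηp ηm d ylh yuh pstar ystar xb xr =
        discPenalty Δt ηp ηm Wh gh d ylh yuh pstar ystar xb xr := fun xb hxb xr hxr =>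
    ⟨contFeasible_iff_discFeasible hΔt hg hW hK hηp hηm hd (fun l hl => (hdrive l hl).1)
        (hXK xb hxb) (hXK xr hxr),
      contPenalty_eq_discPenalty hΔt (hgh.trans_le hghWh) hK hηp hηm (hXK xr hxr) hpstar⟩
  refine ⟨fun xb hxb xr hxr => ⟨(hpoint xb hxb xr hxr).1, by rw [(hpoint xb hxb xr hxr).2]⟩, ?_⟩
  congr 1
  ext v
  refine exists_congr fun xb => and_congr_right fun hxb => exists_congr fun xr =>
    and_congr_right fun hxr => ?_
  rw [(hpoint xb hxb xr hxr).1, (hpoint xb hxb xr hxr).2]
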